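/- arXiv:math/0703549 — 7 statements merged into one kernel-verified Lean document; each statement's English description precedes it below -/
import Mathlib

section
/- For every rational n-set S of P¹ and every matrix γ = (a b; c d) ∈ GL₂(𝔽_q), the identity (cx+d)^n · f_{γ(S)}((ax+b)/(cx+d)) = J(γ,S) · f_S(x) holds in the field of rational functions k̄(x), where γ(S) denotes the image of S under the Möbius action of γ. -/
noncomputable section

open Polynomial

namespace Hyp

attribute [local instance] Classical.propDecidable Classical.decEq

variable (F : Type) [Field F] [Fintype F]

/-- The embedding of `F` into its algebraic closure. -/
def em : F →+* AlgebraicClosure F := algebraMap F (AlgebraicClosure F)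

/-- The Frobenius `t ↦ t^q` acting on `P¹(k̄) = k̄ ∪ {∞}`, where `∞ = none`. -/
def frobP1 : Option (AlgebraicClosure F) → Option (AlgebraicClosure F) :=
  Option.map fun x => x ^ Fintype.card F

variable {F}

/-- The Möbius action of a `2×2` matrix `(a b; c d)` over `F` on `P¹(k̄) = k̄ ∪ {∞}`:
`t ↦ (at+b)/(ct+d)`, with the usual conventions at `∞` and at poles. -/
def moebius (γ : Matrix (Fin 2) (Fin 2) F) :
    Option (AlgebraicClosure F) → Option (AlgebraicClosure F)
  | none =>
      if γ 1 0 = 0 then none else some (em F (γ 0 0) / em F (γ 1 0))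
  | some x =>
      if em F (γ 1 0) * x + em F (γ 1 1) = 0 then none
      else some ((em F (γ 0 0) * x + em F (γ 0 1)) / (em F (γ 1 0) * x + em F (γ 1 1)))

/-- The local multiplier `j(γ,t)`. -/
def locMult (γ : Matrix (Fin 2) (Fin 2) F) :
    Option (AlgebraicClosure F) → AlgebraicClosure F
  | none => if γ 1 0 = 0 then em F (γ 1 1) else em F (-γ.det / γ 1 0)
  | some x =>
      if em F (γ 1 0) * x + em F (γ 1 1) = 0 then em F (γ 1 0)
      else em F γ.det / (em F (γ 1 0) * x + em F (γ 1 1))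

/-- The global multiplier `J(γ,S) = ∏_{t ∈ S} j(γ,t)`. -/
def Jmult (γ : Matrix (Fin 2) (Fin 2) F) (S : Finset (Option (AlgebraicClosure F))) :
    AlgebraicClosure F :=
  ∏ t ∈ S, locMult γ t

/-- `S` is a rational `n`-set of `P¹`: it has `n` elements and is Frobenius-stable. -/
def IsRatSet (n : ℕ) (S : Finset (Option (AlgebraicClosure F))) : Prop :=
  S.card = n ∧ S.image (frobP1 F) = S

/-- `m` is the order of `γ` in `PGL₂(F)`: the least positive integer such that `γ^m`
is a scalar matrix. -/
def IsPGLOrder (γ : Matrix (Fin 2) (Fin 2) F) (m : ℕ) : Prop :=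
  IsLeast {n : ℕ | 0 < n ∧ ∃ lam : F, γ ^ n = lam • (1 : Matrix (Fin 2) (Fin 2) F)} m

/-- `J(γ,S)` is a square in `F*`. -/
def IsSquareJ (γ : Matrix (Fin 2) (Fin 2) F) (S : Finset (Option (AlgebraicClosure F))) : Prop :=
  ∃ v : F, v ≠ 0 ∧ Jmult γ S = em F (v * v)

/-- The monic polynomial `f_S(x) = ∏_{t ∈ S, t ≠ ∞} (x - t)` attached to a finite subset
of `P¹(k̄)`. -/
def fpoly (S : Finset (Option (AlgebraicClosure F))) : Polynomial (AlgebraicClosure F) :=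
  ∏ t ∈ S, t.elim 1 fun a => X - C a

/-- `t` belongs to `P¹(F) = F ∪ {∞}` inside `P¹(k̄)`. -/
def inP1k (t : Option (AlgebraicClosure F)) : Prop :=
  t = none ∨ ∃ x : F, t = some (em F x)

/-- `t` belongs to `P¹(𝔽_{q²})` inside `P¹(k̄)`. -/
def inP1k2 [Fintype F] (t : Option (AlgebraicClosure F)) : Prop :=
  t = none ∨ ∃ x : AlgebraicClosure F, x ^ Fintype.card F ^ 2 = x ∧ t = some x

/-- The Möbius action of an invertible matrix on `P¹(k̄)` is injective. -/
theorem moebius_injective {F : Type} [Field F] {γ : Matrix (Fin 2) (Fin 2) F}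
    (h : γ.det ≠ 0) : Function.Injective (moebius γ) := by
  have hdet : em F (γ 0 0) * em F (γ 1 1) - em F (γ 0 1) * em F (γ 1 0) ≠ 0 := by
    rw [← map_mul, ← map_mul, ← map_sub, ← Matrix.det_fin_two]
    exact (_root_.map_ne_zero _).2 h
  have hzero : γ 1 0 = 0 ↔ em F (γ 1 0) = 0 := (map_eq_zero _).symm
  rintro (_ | s) (_ | t) hst
  · rfl
  · simp only [moebius, hzero] at hst
    split_ifs at hst with h1 h2 h2
    · simp_all
    · rw [Option.some.injEq, div_eq_div_iff h1 h2] at hst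
      exact absurd (by linear_combination hst) hdet
  · simp only [moebius, hzero] at hst
    split_ifs at hst with h1 h2 h2
    · simp_all
    · rw [Option.some.injEq, div_eq_div_iff h1 h2] at hst
      exact absurd (by linear_combination -hst) hdet
  · simp only [moebius] at hst
    congr 1
    split_ifs at hst with h1 h2 h2
    · have hc : em F (γ 1 0) ≠ 0 := by
        intro hc
        simp_all
      exact mul_left_cancel₀ hc (by linear_combination h1 - h2)
    · rw [Option.some.injEq, div_eq_div_iff h1 h2] at hst
      exact mul_left_cancel₀ hdet (by linear_combination hst)

/-- The contribution of a single point `t` to the transformation formula for `f_S`. -/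
theorem locMult_transform {F : Type} [Field F] {γ : Matrix (Fin 2) (Fin 2) F}
    (h : γ.det ≠ 0) (t : Option (AlgebraicClosure F)) :
    (RatFunc.C (em F (γ 1 0)) * RatFunc.X + RatFunc.C (em F (γ 1 1))) *
      Polynomial.aeval
        ((RatFunc.C (em F (γ 0 0)) * RatFunc.X + RatFunc.C (em F (γ 0 1))) /
          (RatFunc.C (em F (γ 1 0)) * RatFunc.X + RatFunc.C (em F (γ 1 1))))
        ((moebius γ t).elim 1 fun u => X - C u)
      = RatFunc.C (locMult γ t) *
        Polynomial.aeval RatFunc.X (t.elim (1 : (AlgebraicClosure F)[X]) fun u => X - C u) := by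
  have hdet : em F γ.det =
      em F (γ 0 0) * em F (γ 1 1) - em F (γ 0 1) * em F (γ 1 0) := by
    rw [← map_mul, ← map_mul, ← map_sub, ← Matrix.det_fin_two]
  have hdet0 : em F γ.det ≠ 0 := (_root_.map_ne_zero _).2 h
  have hzero : γ 1 0 = 0 ↔ em F (γ 1 0) = 0 := (map_eq_zero _).symm
  have hD : RatFunc.C (em F (γ 1 0)) * RatFunc.X + RatFunc.C (em F (γ 1 1)) ≠ 0 := by
    have hp : C (em F (γ 1 0)) * X + C (em F (γ 1 1)) ≠ 0 := by
      intro hp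
      have h0 := congrArg (coeff · 0) hp
      have h1 := congrArg (coeff · 1) hp
      simp at h0 h1
      simp_all
    simpa using (map_ne_zero_iff _ (RatFunc.algebraMap_injective (AlgebraicClosure F))).2 hp
  rcases t with _ | t
  · simp only [moebius, locMult, hzero]
    split_ifs with hc
    · simp [hc]
    · have hC : RatFunc.C (em F (γ 1 0)) ≠ 0 := (_root_.map_ne_zero _).2 hc
      simp only [Option.elim, map_sub, aeval_X, aeval_C, RatFunc.algebraMap_eq_C, map_one, mul_one,
        map_div₀, map_neg, hdet, map_mul]
      field_simp
      ring
  · simp only [moebius, locMult]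
    split_ifs with hc
    · have hC := congrArg RatFunc.C hc
      simp only [map_add, map_mul, map_zero] at hC
      simp only [Option.elim, map_sub, aeval_X, aeval_C, RatFunc.algebraMap_eq_C, map_one, mul_one]
      linear_combination hC
    · have hC : RatFunc.C (em F (γ 1 0) * t + em F (γ 1 1)) ≠ 0 := (_root_.map_ne_zero _).2 hc
      simp only [map_add, map_mul] at hC
      simp only [Option.elim, map_sub, aeval_X, aeval_C, RatFunc.algebraMap_eq_C,
        map_div₀, hdet, map_mul, map_add]
      field_simp
      ring

theorem stmt0 {F : Type} [Field F] [Fintype F] (hq : Odd (Fintype.card F))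
    (n : ℕ) (S : Finset (Option (AlgebraicClosure F))) (hS : IsRatSet n S)
    (γ : GL (Fin 2) F) (a b c d : F)
    (hγ : γ.val = !![a, b; c, d]) :
    (RatFunc.C (em F c) * RatFunc.X + RatFunc.C (em F d)) ^ n *
      Polynomial.aeval
        ((RatFunc.C (em F a) * RatFunc.X + RatFunc.C (em F b)) /
          (RatFunc.C (em F c) * RatFunc.X + RatFunc.C (em F d)))
        (fpoly (S.image (moebius γ.val)))
      = RatFunc.C (Jmult γ.val S) * Polynomial.aeval RatFunc.X (fpoly S) := by
  have hdet : γ.val.det ≠ 0 := (γ.isUnit.map Matrix.detMonoidHom).ne_zero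
  obtain ⟨rfl, rfl, rfl, rfl⟩ : a = γ.val 0 0 ∧ b = γ.val 0 1 ∧ c = γ.val 1 0 ∧ d = γ.val 1 1 := by
    simp [hγ]
  rw [← hS.1, fpoly, fpoly, Jmult, Finset.prod_image (moebius_injective hdet).injOn, map_prod,
    map_prod, map_prod, ← Finset.prod_const, ← Finset.prod_mul_distrib,
    ← Finset.prod_mul_distrib]
  exact Finset.prod_congr rfl fun t _ => locMult_transform hdet t

end Hyp
end
end

section
/- Let S be a rational n-set of P¹. (1) If γ ∈ GL₂(𝔽_q) satisfies γ(S) = S, then J(ργρ⁻¹, ρ(S)) = J(γ,S) for every ρ ∈ GL₂(𝔽_q). (2) The map γ ↦ J(γ,S) is a group homomorphism from the stabilizer GL₂(𝔽_q)_S := {γ ∈ GL₂(𝔽_q) : γ(S) = S} to the multiplicative group k*. -/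
noncomputable section

open Polynomial

namespace Hyp

attribute [local instance] Classical.propDecidable Classical.decEq

variable (F : Type) [Field F] [Fintype F]

variable {F}

/-- A representative in `k̄²` of a point of `P¹(k̄)`; the sign at `∞` is chosen so that the local
multipliers form a cocycle given by `locMult_smul_mulVec_lift`. -/
def lift : Option (AlgebraicClosure F) → Fin 2 → AlgebraicClosure F
  | none => ![-1, 0]
  | some x => ![x, 1]

lemma smul_lift_inj {c d : AlgebraicClosure F} (hc : c ≠ 0) {s t : Option (AlgebraicClosure F)}
    (h : c • lift s = d • lift t) : s = t ∧ c = d := by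
  have h0 := congrFun h 0
  have h1 := congrFun h 1
  rcases s with _ | x <;> rcases t with _ | y <;> simp [lift] at h0 h1 ⊢
  · exact h0
  · simp [← h1, hc] at h0
  · exact hc h1
  · subst h1
    simpa [hc] using h0

lemma locMult_smul_mulVec_lift (γ : Matrix (Fin 2) (Fin 2) F)
    (t : Option (AlgebraicClosure F)) :
    locMult γ t • (γ.map (em F)).mulVec (lift t) = em F γ.det • lift (moebius γ t) := by
  rcases t with _ | x
  · by_cases hc : γ 1 0 = 0
    · ext i
      fin_cases i <;>
        simp [locMult, moebius, lift, hc,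
          Matrix.det_fin_two, mul_comm]
    · have hc' : em F (γ 1 0) ≠ 0 := by simpa using hc
      ext i
      fin_cases i <;>
        simp [locMult, moebius, lift, hc,
          Matrix.det_fin_two] <;> field_simp
      ring
  · by_cases hc : em F (γ 1 0) * x + em F (γ 1 1) = 0
    · ext i
      fin_cases i <;>
        simp [locMult, moebius, lift, hc,
          Matrix.det_fin_two]
      linear_combination em F (γ 0 0) * hc
    · ext i
      fin_cases i <;>
        simp [locMult, moebius, lift, hc,
          Matrix.det_fin_two] <;> field_simp

lemma locMult_ne_zero {γ : Matrix (Fin 2) (Fin 2) F} (hγ : γ.det ≠ 0)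
    (t : Option (AlgebraicClosure F)) : locMult γ t ≠ 0 := by
  intro h
  have h' := locMult_smul_mulVec_lift γ t
  rw [h, zero_smul] at h'
  have hd : em F γ.det ≠ 0 := by simpa using hγ
  have hz : em F γ.det • lift (moebius γ t) = (0 : AlgebraicClosure F) • lift (moebius γ t) := by
    rw [← h', zero_smul]
  exact hd (smul_lift_inj hd hz).2

lemma moebius_mul_and_locMult_mul {γ δ : Matrix (Fin 2) (Fin 2) F} (hγ : γ.det ≠ 0)
    (hδ : δ.det ≠ 0) (t : Option (AlgebraicClosure F)) :
    moebius (γ * δ) t = moebius γ (moebius δ t) ∧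
      locMult (γ * δ) t = locMult γ (moebius δ t) * locMult δ t := by
  have hγδ : (γ * δ).det ≠ 0 := by rw [Matrix.det_mul]; exact mul_ne_zero hγ hδ
  have hd : em F (γ * δ).det ≠ 0 := by simpa using hγδ
  have h := locMult_smul_mulVec_lift (γ * δ) t
  have h₁ := locMult_smul_mulVec_lift γ (moebius δ t)
  have h₂ := locMult_smul_mulVec_lift δ t
  have key : (locMult γ (moebius δ t) * locMult δ t) • ((γ * δ).map (em F)).mulVec (lift t) =
      em F (γ * δ).det • lift (moebius γ (moebius δ t)) := by
    rw [Matrix.map_mul, ← Matrix.mulVec_mulVec, mul_smul, ← Matrix.mulVec_smul, h₂,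
      Matrix.mulVec_smul, smul_comm, h₁, smul_smul, Matrix.det_mul, map_mul, mul_comm]
  have := smul_lift_inj (mul_ne_zero (mul_ne_zero (locMult_ne_zero hγ (moebius δ t))
    (locMult_ne_zero hδ t)) hd) (s := moebius (γ * δ) t) (t := moebius γ (moebius δ t))
    (d := locMult (γ * δ) t * em F (γ * δ).det)
    (by rw [mul_smul, ← h, mul_smul (locMult (γ * δ) t), ← key, smul_comm])
  exact ⟨this.1, (mul_right_cancel₀ hd this.2).symm⟩

lemma det_val_ne_zero (γ : GL (Fin 2) F) : γ.val.det ≠ 0 :=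
  ((Matrix.isUnit_iff_isUnit_det _).1 γ.isUnit).ne_zero

lemma moebius_one (t : Option (AlgebraicClosure F)) :
    moebius (1 : Matrix (Fin 2) (Fin 2) F) t = t := by
  rcases t with _ | x <;> simp [moebius]

lemma moebius_injective_s2 (γ : GL (Fin 2) F) : Function.Injective (moebius γ.val) := by
  refine Function.LeftInverse.injective (g := moebius γ⁻¹.val) fun t => ?_
  rw [← (moebius_mul_and_locMult_mul (det_val_ne_zero γ⁻¹) (det_val_ne_zero γ) t).1,
    ← Units.val_mul, inv_mul_cancel, Units.val_one, moebius_one]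

lemma Jmult_mul (γ δ : GL (Fin 2) F) (S : Finset (Option (AlgebraicClosure F))) :
    Jmult (γ * δ).val S = Jmult γ.val (S.image (moebius δ.val)) * Jmult δ.val S := by
  unfold Jmult
  rw [Finset.prod_image (moebius_injective_s2 δ).injOn, ← Finset.prod_mul_distrib]
  exact Finset.prod_congr rfl fun t _ =>
    (moebius_mul_and_locMult_mul (det_val_ne_zero γ) (det_val_ne_zero δ) t).2

theorem stmt2 {F : Type} [Field F] [Fintype F] (hq : Odd (Fintype.card F))
    (n : ℕ) (S : Finset (Option (AlgebraicClosure F))) (hS : IsRatSet n S) :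
    (∀ γ ρ : GL (Fin 2) F, S.image (moebius γ.val) = S →
        Jmult (ρ * γ * ρ⁻¹).val (S.image (moebius ρ.val)) = Jmult γ.val S) ∧
    (∀ γ₁ γ₂ : GL (Fin 2) F, S.image (moebius γ₁.val) = S →
        S.image (moebius γ₂.val) = S →
        Jmult (γ₁ * γ₂).val S = Jmult γ₁.val S * Jmult γ₂.val S) := by
  refine ⟨fun γ ρ hγ => ?_, fun γ₁ γ₂ _ h₂ => by rw [Jmult_mul, h₂]⟩
  have hρ : Jmult ρ.val S ≠ 0 :=
    Finset.prod_ne_zero_iff.2 fun t _ => locMult_ne_zero (det_val_ne_zero ρ) t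
  apply mul_right_cancel₀ hρ
  rw [← Jmult_mul, inv_mul_cancel_right, Jmult_mul, hγ, mul_comm]

end Hyp
end
end

section
/- Let n be an even integer and S a rational n-set of P¹. If γ ∈ GL₂(𝔽_q) satisfies γ(S) = S and the image of γ in PGL₂(𝔽_q) has odd order (i.e., the least positive integer m with γ^m a scalar matrix is odd), then J(γ,S) is a square in k*. -/
noncomputable section

open Polynomial

namespace Hyp

attribute [local instance] Classical.propDecidable Classical.decEq

variable (F : Type) [Field F] [Fintype F]

variable {F}

/-- A normalized nonzero vector of `k̄²` spanning the line that a point of `P¹(k̄)` stands for. -/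
def liftVec : Option (AlgebraicClosure F) → Fin 2 → AlgebraicClosure F
  | none => ![-1, 0]
  | some x => ![x, 1]

omit [Fintype F] in
theorem eq_of_smul_liftVec_eq {a b : AlgebraicClosure F} (ha : a ≠ 0)
    {s t : Option (AlgebraicClosure F)} (h : a • liftVec s = b • liftVec t) : a = b := by
  have h0 := congrFun h 0
  have h1 := congrFun h 1
  cases s <;> cases t <;> simp [liftVec] at h0 h1 <;> grind

omit [Fintype F] in
theorem locMult_smul_mulVec_liftVec (γ : Matrix (Fin 2) (Fin 2) F) (hγ : γ.det ≠ 0)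
    (t : Option (AlgebraicClosure F)) :
    locMult γ t • (γ.map (em F)).mulVec (liftVec t) = em F γ.det • liftVec (moebius γ t) := by
  have hdet : em F γ.det ≠ 0 := (map_ne_zero (em F)).2 hγ
  have hD : em F γ.det = em F (γ 0 0) * em F (γ 1 1) - em F (γ 0 1) * em F (γ 1 0) := by
    rw [Matrix.det_fin_two]; simp
  cases t with
  | none =>
    by_cases hc : γ 1 0 = 0
    · ext i
      fin_cases i <;> simp [locMult, moebius, liftVec, hc, hD, mul_comm]
    · have hc' : em F (γ 1 0) ≠ 0 := (map_ne_zero (em F)).2 hc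
      ext i
      fin_cases i <;> simp [locMult, moebius, liftVec, hc]
      field_simp
  | some x =>
    by_cases hx : em F (γ 1 0) * x + em F (γ 1 1) = 0
    · ext i
      fin_cases i
      · simp [locMult, moebius, liftVec, hx, hD]
        linear_combination em F (γ 0 0) * hx
      · simp [locMult, moebius, liftVec, hx]
    · ext i
      fin_cases i <;> simp [locMult, moebius, liftVec, hx]
      field_simp

omit [Fintype F] in
theorem prod_locMult_smul_pow_mulVec_liftVec (γ : Matrix (Fin 2) (Fin 2) F) (hγ : γ.det ≠ 0)
    (t : Option (AlgebraicClosure F)) (k : ℕ) :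
    (∏ i ∈ Finset.range k, locMult γ ((moebius γ)^[i] t)) •
        (γ.map (em F) ^ k).mulVec (liftVec t) =
      em F γ.det ^ k • liftVec ((moebius γ)^[k] t) := by
  induction k with
  | zero => simp
  | succ k ih =>
    rw [Finset.prod_range_succ, pow_succ' (γ.map (em F)), ← Matrix.mulVec_mulVec, mul_comm, mul_smul,
      ← Matrix.mulVec_smul, ih, Matrix.mulVec_smul, smul_comm, locMult_smul_mulVec_liftVec γ hγ,
      smul_smul, ← pow_succ, Function.iterate_succ_apply']

theorem prod_iterate_eq {α M : Type*} [DecidableEq α] [CommMonoid M] {S : Finset α} {g : α → α}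
    (hg : S.image g = S) (f : α → M) (i : ℕ) : ∏ t ∈ S, f (g^[i] t) = ∏ t ∈ S, f t := by
  have hinj : Set.InjOn g S := Finset.card_image_iff.1 (congrArg Finset.card hg)
  induction i with
  | zero => rfl
  | succ i ih =>
    simp only [Function.iterate_succ_apply]
    rw [← Finset.prod_image (f := fun t => f (g^[i] t)) hinj, hg, ih]

omit [Fintype F] in
/-- If `γ ^ m = lam` is scalar and `γ` stabilizes `S`, then `J(γ,S)^m` is determined by `det γ`
and `lam`. -/
theorem Jmult_pow_mul (γ : Matrix (Fin 2) (Fin 2) F) (hγ : γ.det ≠ 0)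
    {S : Finset (Option (AlgebraicClosure F))} (hS : S.image (moebius γ) = S) {m : ℕ} {lam : F}
    (hm : γ ^ m = lam • (1 : Matrix (Fin 2) (Fin 2) F)) :
    Jmult γ S ^ m * em F lam ^ S.card = (em F γ.det ^ m) ^ S.card := by
  have hpow : γ.map (em F) ^ m = em F lam • (1 : Matrix (Fin 2) (Fin 2) (AlgebraicClosure F)) := by
    have h := congrArg (em F).mapMatrix hm
    rw [map_pow] at h
    simp only [RingHom.mapMatrix_apply] at h
    rw [h]
    ext i j
    fin_cases i <;> fin_cases j <;> simp
  have hpoint (t : Option (AlgebraicClosure F)) :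
      (∏ i ∈ Finset.range m, locMult γ ((moebius γ)^[i] t)) * em F lam = em F γ.det ^ m := by
    have h := prod_locMult_smul_pow_mulVec_liftVec γ hγ t m
    rw [hpow, Matrix.smul_mulVec, Matrix.one_mulVec, smul_smul] at h
    exact (eq_of_smul_liftVec_eq (pow_ne_zero m ((map_ne_zero (em F)).2 hγ)) h.symm).symm
  have hprod := Finset.prod_congr (rfl : S = S) fun t _ => hpoint t
  rw [Finset.prod_mul_distrib, Finset.prod_comm, Finset.prod_const, Finset.prod_const,
    Finset.prod_congr rfl fun i _ => prod_iterate_eq hS (locMult γ) i, Finset.prod_const,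
    Finset.card_range] at hprod
  exact hprod

theorem em_pow_card (a : F) : em F a ^ Fintype.card F = em F a := by
  rw [← map_pow, FiniteField.pow_card]

theorem linear_pow_card (a b : F) (x : AlgebraicClosure F) :
    (em F a * x + em F b) ^ Fintype.card F = em F a * x ^ Fintype.card F + em F b := by
  have h := map_add (FiniteField.frobeniusAlgHom F (AlgebraicClosure F)) (em F a * x) (em F b)
  simpa [FiniteField.frobeniusAlgHom_apply, mul_pow, em_pow_card] using h

theorem locMult_frobP1 (γ : Matrix (Fin 2) (Fin 2) F) (t : Option (AlgebraicClosure F)) :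
    locMult γ (frobP1 F t) = locMult γ t ^ Fintype.card F := by
  cases t with
  | none =>
    simp only [frobP1, Option.map_none, locMult]
    split_ifs <;> rw [em_pow_card]
  | some x =>
    simp only [frobP1, Option.map_some, locMult, ← linear_pow_card,
      pow_eq_zero_iff Fintype.card_ne_zero]
    split_ifs <;> simp only [div_pow, em_pow_card]

theorem mem_range_em_of_pow_card_eq {x : AlgebraicClosure F} (hx : x ^ Fintype.card F = x) :
    ∃ a : F, em F a = x := by
  have h : x ∈ ((X ^ Fintype.card F - X : F[X]).map (em F)).roots := by
    rw [mem_roots (Polynomial.map_ne_zero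
      (FiniteField.X_pow_card_sub_X_ne_zero F Fintype.one_lt_card))]
    simp [hx]
  have hs : (X ^ Fintype.card F - X : F[X]).Splits := by
    simpa using Polynomial.splits_X_pow_nat_card_sub_X (K := F)
  rw [hs.roots_map] at h
  obtain ⟨a, -, ha⟩ := Multiset.mem_map.1 h
  exact ⟨a, ha⟩

theorem exists_em_eq_Jmult (γ : Matrix (Fin 2) (Fin 2) F)
    {S : Finset (Option (AlgebraicClosure F))} (hS : S.image (frobP1 F) = S) :
    ∃ a : F, em F a = Jmult γ S := by
  apply mem_range_em_of_pow_card_eq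
  rw [Jmult, ← Finset.prod_pow, ← prod_iterate_eq hS (locMult γ) 1]
  exact Finset.prod_congr rfl fun t _ => (locMult_frobP1 γ t).symm

theorem stmt3 {F : Type} [Field F] [Fintype F] (hq : Odd (Fintype.card F))
    (n : ℕ) (hn : Even n) (S : Finset (Option (AlgebraicClosure F))) (hS : IsRatSet n S)
    (γ : GL (Fin 2) F) (hstab : S.image (moebius γ.val) = S)
    (m : ℕ) (hm : IsPGLOrder γ.val m) (hodd : Odd m) :
    IsSquareJ γ.val S := by
  obtain ⟨⟨-, lam, hlam⟩, -⟩ := hm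
  have hdet : γ.val.det ≠ 0 := γ.det.ne_zero
  obtain ⟨a, ha⟩ := exists_em_eq_Jmult γ.val hS.2
  have hJ := Jmult_pow_mul γ.val hdet hstab hlam
  rw [← ha, hS.1, ← map_pow, ← map_pow, ← map_pow, ← map_mul, ← map_pow] at hJ
  replace hJ := (em F).injective hJ
  have hne : a ^ m * lam ^ n ≠ 0 := hJ ▸ pow_ne_zero n (pow_ne_zero m hdet)
  have ha0 : a ≠ 0 := fun h => left_ne_zero_of_mul hne (by rw [h, zero_pow hodd.pos.ne'])
  have hsq : IsSquare (a ^ m) := by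
    rw [eq_div_of_mul_eq (right_ne_zero_of_mul hne) hJ]
    exact (hn.isSquare_pow _).div (hn.isSquare_pow _)
  have hsqa : IsSquare a := by
    obtain ⟨k, rfl⟩ := hodd
    have h : a = a ^ (2 * k + 1) / a ^ (2 * k) := by
      field_simp
      ring
    rw [h]
    exact hsq.div ((even_two_mul k).isSquare_pow _)
  obtain ⟨v, hv⟩ := hsqa
  exact ⟨v, fun h => ha0 (by simp [hv, h]), by rw [← ha, hv]⟩

end Hyp
end
end

section
/- Let q be an odd prime power, α ∈ 𝔽_{q²} ∖ 𝔽_q, and let m be the least positive integer such that α^m ∈ 𝔽_q (equivalently, the order of the class of α in the cyclic group 𝔽_{q²}*/𝔽_q*). Then m divides q+1, and the norm N_{𝔽_{q²}/𝔽_q}(α) = α^{q+1} is a square in 𝔽_q* if and only if (q+1)/m is even. -/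
noncomputable section

open Polynomial

namespace Hyp

attribute [local instance] Classical.propDecidable Classical.decEq

variable (F : Type) [Field F] [Fintype F]

variable {F}

theorem mem_range_algebraMap_iff_pow_card {K L : Type*} [Field K] [Fintype K] [Field L]
    [Algebra K L] (x : L) : x ∈ Set.range (algebraMap K L) ↔ x ^ Fintype.card K = x := by
  constructor
  · rintro ⟨y, rfl⟩
    rw [← map_pow, FiniteField.pow_card]
  · intro hx
    have hP : (X ^ Fintype.card K - X : L[X]) ≠ 0 :=
      FiniteField.X_pow_card_sub_X_ne_zero L Fintype.one_lt_card
    have hsub : Finset.univ.image (algebraMap K L) ⊆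
        (X ^ Fintype.card K - X : L[X]).roots.toFinset := by
      intro z hz
      obtain ⟨y, -, rfl⟩ := Finset.mem_image.1 hz
      simp [mem_roots hP, ← map_pow, FiniteField.pow_card]
    have heq := Finset.eq_of_subset_of_card_le hsub (by
      rw [Finset.card_image_of_injective _ (algebraMap K L).injective, Finset.card_univ]
      refine (Multiset.toFinset_card_le _).trans ((card_roots' _).trans ?_)
      rw [FiniteField.X_pow_card_sub_X_natDegree_eq L Fintype.one_lt_card])
    have hmem : x ∈ (X ^ Fintype.card K - X : L[X]).roots.toFinset := by
      simp [mem_roots hP, hx]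
    rw [← heq] at hmem
    obtain ⟨y, -, hy⟩ := Finset.mem_image.1 hmem
    exact ⟨y, hy⟩

theorem mem_range_algebraMap_iff_pow_card_sub_one {K L : Type*} [Field K] [Fintype K] [Field L]
    [Algebra K L] {x : L} (hx : x ≠ 0) :
    x ∈ Set.range (algebraMap K L) ↔ x ^ (Fintype.card K - 1) = 1 := by
  rw [mem_range_algebraMap_iff_pow_card,
    ← mul_left_inj' hx (a := x ^ (Fintype.card K - 1)), ← pow_succ,
    Nat.sub_add_cancel Fintype.card_pos, one_mul]

theorem stmt7 {F E : Type} [Field F] [Fintype F] [Field E] [Fintype E] [Algebra F E]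
    (hq : Odd (Fintype.card F)) (hE : Fintype.card E = Fintype.card F ^ 2)
    (α : E) (hα : α ∉ Set.range (algebraMap F E))
    (m : ℕ)
    (hm : IsLeast {n : ℕ | 0 < n ∧ α ^ n ∈ Set.range (algebraMap F E)} m) :
    m ∣ Fintype.card F + 1 ∧
    ((∃ v : F, v ≠ 0 ∧ α ^ (Fintype.card F + 1) = algebraMap F E (v * v)) ↔
      Even ((Fintype.card F + 1) / m)) := by
  have hα0 : α ≠ 0 := by
    rintro rfl
    exact hα ⟨0, map_zero _⟩
  have hrange (n : ℕ) :
      α ^ n ∈ Set.range (algebraMap F E) ↔ (α ^ (Fintype.card F - 1)) ^ n = 1 := by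
    rw [mem_range_algebraMap_iff_pow_card_sub_one (pow_ne_zero n hα0), pow_right_comm]
  have hm0 : 0 < m := hm.1.1
  have hord : orderOf (α ^ (Fintype.card F - 1)) = m :=
    (orderOf_eq_iff hm0).2 ⟨(hrange m).1 hm.1.2,
      fun n hn hn0 h => hn.not_ge (hm.2 ⟨hn0, (hrange n).2 h⟩)⟩
  have hnorm : (α ^ (Fintype.card F - 1)) ^ (Fintype.card F + 1) = 1 := by
    rw [← pow_mul, mul_comm, ← Nat.sq_sub_sq, one_pow, ← hE,
      FiniteField.pow_card_sub_one_eq_one α hα0]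
  have hdvd : m ∣ Fintype.card F + 1 := hord ▸ orderOf_dvd_of_pow_eq_one hnorm
  refine ⟨hdvd, ?_⟩
  obtain ⟨a, ha⟩ := (hrange _).2 hnorm
  have ha0 : a ≠ 0 := by
    rintro rfl
    rw [map_zero] at ha
    exact pow_ne_zero _ hα0 ha.symm
  have hchar : ringChar F ≠ 2 := fun h =>
    Nat.not_even_iff_odd.2 hq (Nat.even_iff.2 (FiniteField.even_card_iff_char_two.1 h))
  have hsq : (∃ v : F, v ≠ 0 ∧ α ^ (Fintype.card F + 1) = algebraMap F E (v * v)) ↔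
      IsSquare a := by
    simp only [← ha, (algebraMap F E).injective.eq_iff]
    exact ⟨fun ⟨v, _, hv⟩ => ⟨v, hv⟩,
      fun ⟨v, hv⟩ => ⟨v, fun h => ha0 (by rw [hv, h, mul_zero]), hv⟩⟩
  rw [hsq, FiniteField.isSquare_iff hchar ha0, ← (algebraMap F E).injective.eq_iff, map_pow, ha,
    map_one]
  obtain ⟨k, hk⟩ := hq
  have hexp : (α ^ (Fintype.card F + 1)) ^ (Fintype.card F / 2) =
      (α ^ (Fintype.card F - 1)) ^ (k + 1) := by
    rw [← pow_mul, ← pow_mul]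
    congr 1
    rw [show Fintype.card F / 2 = k by lia, show Fintype.card F - 1 = 2 * k by lia, hk]
    ring
  rw [hexp, ← orderOf_dvd_iff_pow_eq_one, hord, even_iff_two_dvd, Nat.dvd_div_iff_mul_dvd hdvd,
    show Fintype.card F + 1 = (k + 1) * 2 by lia, Nat.mul_dvd_mul_iff_right two_pos]

end Hyp
end
end

section
/- Let q be an odd prime power, α ∈ 𝔽_{q²} ∖ 𝔽_q, and let m be the least positive integer such that α^m ∈ 𝔽_q. If m is even, then α^m is not a square in 𝔽_q*. -/
noncomputable section

open Polynomial

namespace Hyp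

attribute [local instance] Classical.propDecidable Classical.decEq

variable (F : Type) [Field F] [Fintype F]

variable {F}

theorem stmt8 {F E : Type} [Field F] [Fintype F] [Field E] [Fintype E] [Algebra F E]
    (hq : Odd (Fintype.card F)) (hE : Fintype.card E = Fintype.card F ^ 2)
    (α : E) (hα : α ∉ Set.range (algebraMap F E))
    (m : ℕ)
    (hm : IsLeast {n : ℕ | 0 < n ∧ α ^ n ∈ Set.range (algebraMap F E)} m)
    (hmeven : Even m) :
    ¬ ∃ v : F, v ≠ 0 ∧ α ^ m = algebraMap F E (v * v) := by
  rintro ⟨v, -, hv⟩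
  obtain ⟨k, rfl⟩ := hmeven
  have hpos := hm.1.1
  have hk : α ^ k ∈ Set.range (algebraMap F E) := by
    rw [pow_add, map_mul] at hv
    rcases mul_self_eq_mul_self_iff.mp hv with h | h
    · exact ⟨v, h.symm⟩
    · exact ⟨-v, by rw [map_neg, h]⟩
  have hle := hm.2 (show k ∈ {n : ℕ | 0 < n ∧ α ^ n ∈ Set.range (algebraMap F E)} from
    ⟨by omega, hk⟩)
  omega

end Hyp
end
end

section
/- For every integer n ≥ 3, the number of n-element subsets S ⊆ P¹(k̄) with σ(S) = S equals q^n − q^{n−2}. -/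
noncomputable section

open Polynomial

namespace Hyp

attribute [local instance] Classical.propDecidable Classical.decEq

variable (F : Type) [Field F] [Fintype F]

variable {F}

section StableMultisets

variable {α : Type*}

/-- The multisets of cardinality `n` that are invariant under the permutation `e`. -/
def StableMultiset (e : α ≃ α) (n : ℕ) : Type _ :=
  {m : Multiset α // m.card = n ∧ m.map e = m}

/-- The finite sets of cardinality `n` that are invariant under the permutation `e`. -/
def StableFinset (e : α ≃ α) (n : ℕ) : Type _ :=
  {S : Finset α // S.card = n ∧ S.map e.toEmbedding = S}

theorem exists_two_nsmul_add_nodup (m : Multiset α) :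
    ∃ a b : Multiset α, b.Nodup ∧ 2 • a + b = m := by
  induction m using Multiset.induction with
  | empty => exact ⟨0, 0, Multiset.nodup_zero, by simp⟩
  | cons x m ih =>
    obtain ⟨a, b, hb, rfl⟩ := ih
    by_cases hx : x ∈ b
    · obtain ⟨c, rfl⟩ := Multiset.exists_cons_of_mem hx
      refine ⟨x ::ₘ a, c, (Multiset.nodup_cons.1 hb).2, ?_⟩
      simp only [two_nsmul, ← Multiset.singleton_add]
      abel
    · refine ⟨a, x ::ₘ b, Multiset.nodup_cons.2 ⟨hx, hb⟩, ?_⟩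
      rw [Multiset.add_cons]

theorem two_nsmul_add_nodup_injective {a b a' b' : Multiset α} (hb : b.Nodup) (hb' : b'.Nodup)
    (h : 2 • a + b = 2 • a' + b') : a = a' ∧ b = b' := by
  have key : ∀ x, a.count x = a'.count x ∧ b.count x = b'.count x := fun x => by
    have hx := congrArg (Multiset.count x) h
    have h1 := Multiset.nodup_iff_count_le_one.1 hb x
    have h2 := Multiset.nodup_iff_count_le_one.1 hb' x
    simp only [Multiset.count_add, Multiset.count_nsmul] at hx
    omega
  exact ⟨Multiset.ext.2 fun x => (key x).1, Multiset.ext.2 fun x => (key x).2⟩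

/-- Double the first multiset and add the second one. -/
def doubleAdd (e : α ≃ α) (n : ℕ)
    (p : Σ i : Fin (n / 2 + 1), StableMultiset e i × StableFinset e (n - 2 * i)) :
    StableMultiset e n :=
  ⟨2 • p.2.1.1 + p.2.2.1.1, by
    obtain ⟨⟨i, hi⟩, ⟨a, ha, hae⟩, ⟨b, hb, hbe⟩⟩ := p
    have hbe' := congrArg Finset.val hbe
    simp only [Finset.map_val, Equiv.coe_toEmbedding] at hbe'
    refine ⟨?_, by simp only [Multiset.map_add, Multiset.map_nsmul, hae, hbe']⟩
    simp only [Multiset.card_add, Multiset.card_nsmul, ha, Finset.card_val, hb]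
    omega⟩

theorem doubleAdd_bijective (e : α ≃ α) (n : ℕ) : Function.Bijective (doubleAdd e n) := by
  constructor
  · rintro ⟨⟨i, hi⟩, ⟨a, ha, hae⟩, ⟨b, hb, hbe⟩⟩ ⟨⟨j, hj⟩, ⟨a', ha', hae'⟩, ⟨b', hb', hbe'⟩⟩ h
    obtain ⟨rfl, hbb⟩ := two_nsmul_add_nodup_injective b.nodup b'.nodup (congrArg Subtype.val h)
    obtain rfl := Finset.val_injective hbb
    dsimp only at ha ha'
    subst ha
    subst ha'
    rfl
  · rintro ⟨m, hm, hme⟩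
    obtain ⟨a, b, hb, rfl⟩ := exists_two_nsmul_add_nodup m
    rw [Multiset.map_add, Multiset.map_nsmul] at hme
    obtain ⟨hae, hbe⟩ := two_nsmul_add_nodup_injective (hb.map e.injective) hb hme
    simp only [Multiset.card_add, Multiset.card_nsmul] at hm
    refine ⟨⟨⟨a.card, by omega⟩, ⟨a, rfl, hae⟩, ⟨⟨b, hb⟩, ?_, Finset.val_injective ?_⟩⟩, ?_⟩
    · simp only [Finset.card_mk]
      omega
    · simpa using hbe
    · rfl

instance finite_stableFinset (e : α ≃ α) (n : ℕ) [Finite (StableMultiset e n)] :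
    Finite (StableFinset e n) :=
  Finite.of_injective (β := StableMultiset e n)
    (fun S => ⟨S.1.val, S.2.1, by simpa using congrArg Finset.val S.2.2⟩)
    fun _ _ h => Subtype.ext (Finset.val_injective (congrArg Subtype.val h))

theorem card_stableMultiset (e : α ≃ α) [∀ n, Finite (StableMultiset e n)] (n : ℕ) :
    Nat.card (StableMultiset e n) = ∑ i ∈ Finset.range (n / 2 + 1),
      Nat.card (StableMultiset e i) * Nat.card (StableFinset e (n - 2 * i)) := by
  rw [← Nat.card_congr (Equiv.ofBijective _ (doubleAdd_bijective e n)), Nat.card_sigma]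
  simp only [Nat.card_prod]
  exact Fin.sum_univ_eq_sum_range
    (fun i => Nat.card (StableMultiset e i) * Nat.card (StableFinset e (n - 2 * i))) _

/-- If there are `q ^ n` invariant multisets for every `n`, then for `n ≥ 2` all but `q ^ (n - 1)`
of them have no repeated element. -/
theorem card_stableFinset_add (e : α ≃ α) [∀ n, Finite (StableMultiset e n)] (q : ℕ)
    (hq : ∀ n, Nat.card (StableMultiset e n) = q ^ n) (n : ℕ) :
    Nat.card (StableFinset e (n + 2)) + q ^ (n + 1) = q ^ (n + 2) := by
  have h1 := card_stableMultiset e (n + 2)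
  have h0 := card_stableMultiset e n
  simp only [hq] at h0 h1
  rw [show (n + 2) / 2 + 1 = n / 2 + 1 + 1 by omega, Finset.sum_range_succ'] at h1
  have h2 : ∀ i, n + 2 - 2 * (i + 1) = n - 2 * i := fun i => by omega
  simp only [h2, pow_succ', mul_assoc, ← Finset.mul_sum] at h1
  rw [← h0] at h1
  simp only [pow_zero, one_mul, mul_zero, Nat.sub_zero] at h1
  simp only [pow_succ']
  omega

theorem card_stableFinset_optionCongr (e : α ≃ α) (n : ℕ) [∀ n, Finite (StableFinset e n)] :
    Nat.card (StableFinset e.optionCongr (n + 1)) =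
      Nat.card (StableFinset e (n + 1)) + Nat.card (StableFinset e n) := by
  rw [← Nat.card_sum]
  symm
  have hsome : ∀ T : Finset α, (T.map Function.Embedding.some).map e.optionCongr.toEmbedding =
      (T.map e.toEmbedding).map Function.Embedding.some := fun T => by
    ext x; cases x <;> simp [← Equiv.optionCongr_symm]
  have hins : ∀ T : Finset α, T.insertNone.map e.optionCongr.toEmbedding =
      (T.map e.toEmbedding).insertNone := fun T => by
    ext x; cases x <;> simp [Finset.mem_insertNone, ← Equiv.optionCongr_symm]
  let f : StableFinset e (n + 1) ⊕ StableFinset e n → StableFinset e.optionCongr (n + 1) :=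
    Sum.elim
      (fun T => ⟨T.1.map Function.Embedding.some, by rw [Finset.card_map, T.2.1],
        by rw [hsome, T.2.2]⟩)
      (fun T => ⟨T.1.insertNone, by rw [Finset.card_insertNone, T.2.1], by rw [hins, T.2.2]⟩)
  refine Nat.card_congr (Equiv.ofBijective f ⟨?_, ?_⟩)
  · refine Function.Injective.sumElim (fun T T' h => ?_) (fun T T' h => ?_) (fun T T' h => ?_)
    · exact Subtype.ext (Finset.map_injective _ (congrArg Subtype.val h))
    · exact Subtype.ext (Finset.insertNone.injective (congrArg Subtype.val h))
    · have := congrArg (fun S => none ∈ S.1) h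
      simp at this
  · rintro ⟨S, hS, hSe⟩
    by_cases hn : none ∈ S
    · obtain ⟨T, rfl⟩ : ∃ T : Finset α, S = T.insertNone :=
        ⟨S.eraseNone, by rw [Finset.insertNone_eraseNone, Finset.insert_eq_of_mem hn]⟩
      rw [hins] at hSe
      rw [Finset.card_insertNone] at hS
      exact ⟨Sum.inr ⟨T, by omega, Finset.insertNone.injective hSe⟩, rfl⟩
    · obtain ⟨T, rfl⟩ : ∃ T : Finset α, S = T.map Function.Embedding.some :=
        ⟨S.eraseNone, by rw [Finset.map_some_eraseNone, Finset.erase_eq_of_notMem hn]⟩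
      rw [hsome] at hSe
      rw [Finset.card_map] at hS
      exact ⟨Sum.inl ⟨T, hS, Finset.map_injective _ hSe⟩, rfl⟩

end StableMultisets

section Frobenius

variable (F : Type) [Field F] [Fintype F]

/-- The Frobenius automorphism of the algebraic closure of `F`. -/
abbrev frob : AlgebraicClosure F ≃ₐ[F] AlgebraicClosure F :=
  FiniteField.frobeniusAlgEquivOfAlgebraic F (AlgebraicClosure F)

theorem exists_algebraMap_eq_of_pow_card_eq {K : Type*} [Field K] [Algebra F K] (x : K)
    (hx : x ^ Fintype.card F = x) : ∃ y : F, algebraMap F K y = x := by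
  have h := roots_map_of_injective_of_card_eq_natDegree (p := (X ^ Fintype.card F - X : F[X]))
    (algebraMap F K).injective (by
      rw [FiniteField.roots_X_pow_card_sub_X,
        FiniteField.X_pow_card_sub_X_natDegree_eq F Fintype.one_lt_card]
      rfl)
  have hx' : x ∈ ((X ^ Fintype.card F - X : F[X]).map (algebraMap F K)).roots := by
    rw [Polynomial.map_sub, Polynomial.map_pow, map_X,
      mem_roots (FiniteField.X_pow_card_sub_X_ne_zero K Fintype.one_lt_card)]
    simp [hx]
  rw [← h, Multiset.mem_map] at hx'
  exact hx'.imp fun _ hy => hy.2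

theorem roots_map_frob_eq (f : F[X]) :
    (f.map (algebraMap F (AlgebraicClosure F))).roots.map (frob F) =
      (f.map (algebraMap F (AlgebraicClosure F))).roots := by
  have h := Splits.roots_map_of_injective
    (IsAlgClosed.splits (f.map (algebraMap F (AlgebraicClosure F))))
    (i := ((frob F : AlgebraicClosure F →ₐ[F] AlgebraicClosure F) :
      AlgebraicClosure F →+* AlgebraicClosure F)) (frob F).injective
  rw [Polynomial.map_map, AlgHom.comp_algebraMap] at h
  exact h.symm

/-- The multiset of roots of a monic polynomial of degree `n` over `F`. -/
def monicRoots (n : ℕ) (f : {p : F[X] // p.Monic ∧ p.natDegree = n}) :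
    StableMultiset (frob F).toEquiv n :=
  ⟨(f.1.map (algebraMap F (AlgebraicClosure F))).roots, by
    rw [← (IsAlgClosed.splits _).natDegree_eq_card_roots, natDegree_map, f.2.2],
    roots_map_frob_eq F f.1⟩

theorem monicRoots_bijective (n : ℕ) : Function.Bijective (monicRoots F n) := by
  constructor
  · rintro ⟨f, hf, hfn⟩ ⟨g, hg, hgn⟩ h
    have h' : (f.map (algebraMap F (AlgebraicClosure F))).roots =
        (g.map (algebraMap F (AlgebraicClosure F))).roots := congrArg Subtype.val h
    refine Subtype.ext (Polynomial.map_injective _ (algebraMap F (AlgebraicClosure F)).injective ?_)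
    rw [(IsAlgClosed.splits _).eq_prod_roots_of_monic (hf.map _),
      (IsAlgClosed.splits _).eq_prod_roots_of_monic (hg.map _), h']
  · rintro ⟨m, hm, hme⟩
    set P := (m.map fun a => X - C a).prod with hP
    have hPmonic : P.Monic := monic_multiset_prod_of_monic _ _ fun a _ => monic_X_sub_C a
    have hPe : P.map ((frob F : AlgebraicClosure F →ₐ[F] AlgebraicClosure F) :
        AlgebraicClosure F →+* AlgebraicClosure F) = P := by
      rw [hP, Polynomial.map_multiset_prod, Multiset.map_map]
      conv_rhs => rw [← hme, Multiset.map_map]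
      simp
    have hlift : P ∈ lifts (algebraMap F (AlgebraicClosure F)) := by
      rw [lifts_iff_coeff_lifts]
      intro i
      refine exists_algebraMap_eq_of_pow_card_eq F _ ?_
      conv_rhs => rw [← hPe, coeff_map]
      simp
    obtain ⟨f, hfP, hfdeg, hf⟩ := lifts_and_natDegree_eq_and_monic hlift hPmonic
    refine ⟨⟨f, hf, ?_⟩, Subtype.ext ?_⟩
    · rw [hfdeg, hP, natDegree_multiset_prod_X_sub_C_eq_card, hm]
    · change (f.map _).roots = m
      rw [hfP, hP, roots_multiset_prod_X_sub_C]

/-- Invariant multisets of the algebraic closure correspond to vectors of coefficients. -/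
def coeffEquivStableMultiset (n : ℕ) : (Fin n → F) ≃ StableMultiset (frob F).toEquiv n :=
  ((monicEquivDegreeLT n).trans (degreeLTEquiv F n).toEquiv).symm.trans
    (Equiv.ofBijective _ (monicRoots_bijective F n))

instance finite_stableMultiset_frob (n : ℕ) : Finite (StableMultiset (frob F).toEquiv n) :=
  Finite.of_equiv _ (coeffEquivStableMultiset F n)

theorem card_stableMultiset_frob (n : ℕ) :
    Nat.card (StableMultiset (frob F).toEquiv n) = Fintype.card F ^ n := by
  rw [← Nat.card_congr (coeffEquivStableMultiset F n)]
  simp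

theorem frobP1_eq : frobP1 F = (frob F).toEquiv.optionCongr := by
  ext1 x
  cases x <;> simp [frobP1]

end Frobenius

theorem stmt10 {F : Type} [Field F] [Fintype F] (n : ℕ) (hn : 3 ≤ n) :
    Set.ncard {S : Finset (Option (AlgebraicClosure F)) |
        S.card = n ∧ S.image (frobP1 F) = S}
      = Fintype.card F ^ n - Fintype.card F ^ (n - 2) := by
  have h1 := card_stableFinset_add (frob F).toEquiv _ (card_stableMultiset_frob F) (n - 2)
  have h2 := card_stableFinset_add (frob F).toEquiv _ (card_stableMultiset_frob F) (n - 3)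
  have h3 := card_stableFinset_optionCongr (frob F).toEquiv (n - 1)
  rw [show n - 2 + 2 = n by omega, show n - 2 + 1 = n - 1 by omega] at h1
  rw [show n - 3 + 2 = n - 1 by omega, show n - 3 + 1 = n - 2 by omega] at h2
  rw [show n - 1 + 1 = n by omega] at h3
  have h4 : Set.ncard {S : Finset (Option (AlgebraicClosure F)) |
      S.card = n ∧ S.image (frobP1 F) = S} =
      Nat.card (StableFinset (frob F).toEquiv.optionCongr n) := by
    rw [← Nat.card_coe_set_eq]
    refine Nat.card_congr (Equiv.subtypeEquivRight fun S => ?_)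
    rw [Finset.map_eq_image, Equiv.coe_toEmbedding, ← frobP1_eq]
    rfl
  omega

end Hyp
end
end

section
/- Let t₀ ∈ P¹(𝔽_{q²}) ∖ P¹(𝔽_q) and let P¹₀ := P¹(k̄) ∖ {t₀, σ(t₀)}. For every integer n ≥ 1, the number of n-element subsets S ⊆ P¹₀ with σ(S) = S equals (q+1)·(q^{n+1} − q^n − (−1)^{⌈n/2⌉}·q + (−1)^{⌈(n−1)/2⌉})/(q²+1). -/
noncomputable section

open Polynomial

namespace Hyp

attribute [local instance] Classical.propDecidable Classical.decEq

variable (F : Type) [Field F] [Fintype F]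

variable {F}

section StableSets

variable {X : Type*}

/-- Multisets of size `n` fixed by `τ`. -/
def stableMultisets (τ : X → X) (n : ℕ) : Set (Multiset X) :=
  {m | m.card = n ∧ m.map τ = m}

/-- Finite subsets of size `n` fixed by `τ`, which is required to act injectively on them. -/
def stableFinsets (τ : X → X) (n : ℕ) : Set (Finset X) :=
  {S | S.card = n ∧ S.val.map τ = S.val}

theorem exists_nodup_add_two_nsmul (m : Multiset X) :
    ∃ S E : Multiset X, S.Nodup ∧ S + 2 • E = m := by
  induction m using Multiset.induction_on with
  | empty => exact ⟨0, 0, Multiset.nodup_zero, by simp⟩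
  | cons a m ih =>
    obtain ⟨S, E, hS, rfl⟩ := ih
    by_cases ha : a ∈ S
    · obtain ⟨T, rfl⟩ := Multiset.exists_cons_of_mem ha
      refine ⟨T, a ::ₘ E, (Multiset.nodup_cons.1 hS).2, ?_⟩
      simp only [← Multiset.singleton_add, two_nsmul]
      abel
    · exact ⟨a ::ₘ S, E, Multiset.nodup_cons.2 ⟨ha, hS⟩, by simp⟩

theorem nodup_add_two_nsmul_inj {S S' E E' : Multiset X} (hS : S.Nodup) (hS' : S'.Nodup)
    (h : S + 2 • E = S' + 2 • E') : S = S' ∧ E = E' := by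
  have key : ∀ a, S.count a = S'.count a ∧ E.count a = E'.count a := by
    intro a
    have h1 := Multiset.nodup_iff_count_le_one.1 hS a
    have h2 := Multiset.nodup_iff_count_le_one.1 hS' a
    have h3 := congrArg (Multiset.count a) h
    simp only [Multiset.count_add, Multiset.count_nsmul] at h3
    omega
  exact ⟨Multiset.ext.2 fun a => (key a).1, Multiset.ext.2 fun a => (key a).2⟩

theorem map_add_two_nsmul_eq_iff {τ : X → X} (hτ : τ.Injective) {S E : Multiset X}
    (hS : S.Nodup) :
    (S + 2 • E).map τ = S + 2 • E ↔ S.map τ = S ∧ E.map τ = E := by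
  rw [Multiset.map_add, Multiset.map_nsmul]
  constructor
  · exact nodup_add_two_nsmul_inj (hS.map hτ) hS
  · rintro ⟨h1, h2⟩
    rw [h1, h2]

theorem finite_stableFinsets {τ : X → X} {n : ℕ} (h : (stableMultisets τ n).Finite) :
    (stableFinsets τ n).Finite :=
  Set.Finite.of_finite_image (f := Finset.val)
    (h.subset (by rintro _ ⟨S, hS, rfl⟩; exact hS)) Finset.val_injective.injOn

theorem ncard_stableMultisets {τ : X → X} (hτ : τ.Injective)
    (hfin : ∀ n, (stableMultisets τ n).Finite) (n : ℕ) :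
    (stableMultisets τ n).ncard = ∑ b ∈ Finset.range (n / 2 + 1),
      (stableFinsets τ (n - 2 * b)).ncard * (stableMultisets τ b).ncard := by
  have hfin' : ∀ n, (stableFinsets τ n).Finite := fun n => finite_stableFinsets (hfin n)
  simp_rw [fun n => Set.ncard_eq_toFinset_card _ (hfin n),
    fun n => Set.ncard_eq_toFinset_card _ (hfin' n), ← Finset.card_product, ← Finset.card_sigma]
  symm
  refine Finset.card_bij (fun p _ => p.2.1.val + 2 • p.2.2) ?_ ?_ ?_
  · rintro ⟨b, S, E⟩ h
    simp only [Finset.mem_sigma, Finset.mem_range, Finset.mem_product, Set.Finite.mem_toFinset,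
      stableFinsets, stableMultisets, Set.mem_ofPred_eq] at h ⊢
    obtain ⟨hb, ⟨h1, h2⟩, h3, h4⟩ := h
    refine ⟨?_, (map_add_two_nsmul_eq_iff hτ S.nodup).2 ⟨h2, h4⟩⟩
    rw [Multiset.card_add, Multiset.card_nsmul, Finset.card_val]
    omega
  · rintro ⟨b, S, E⟩ h ⟨b', S', E'⟩ h' heq
    simp only [Finset.mem_sigma, Finset.mem_range, Finset.mem_product, Set.Finite.mem_toFinset,
      stableFinsets, stableMultisets, Set.mem_ofPred_eq] at h h'
    obtain ⟨h1, h2⟩ := nodup_add_two_nsmul_inj S.nodup S'.nodup heq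
    obtain rfl := Finset.val_injective h1
    subst h2
    obtain rfl : b = b' := h.2.2.1.symm.trans h'.2.2.1
    rfl
  · intro m hm
    simp only [Set.Finite.mem_toFinset, stableMultisets, Set.mem_ofPred_eq] at hm
    obtain ⟨S, E, hS, rfl⟩ := exists_nodup_add_two_nsmul m
    obtain ⟨hc, hm⟩ := hm
    rw [map_add_two_nsmul_eq_iff hτ hS] at hm
    rw [Multiset.card_add, Multiset.card_nsmul] at hc
    refine ⟨⟨E.card, ⟨S, hS⟩, E⟩, ?_, rfl⟩
    simp only [Finset.mem_sigma, Finset.mem_range, Finset.mem_product, Set.Finite.mem_toFinset,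
      stableFinsets, stableMultisets, Set.mem_ofPred_eq, Finset.card_mk]
    exact ⟨by omega, ⟨by omega, hm.1⟩, trivial, hm.2⟩

theorem ncard_stableFinsets_of_pow {τ : X → X} (hτ : τ.Injective) {q : ℕ}
    (hfin : ∀ n, (stableMultisets τ n).Finite)
    (hq : ∀ n, (stableMultisets τ n).ncard = q ^ n) :
    (stableFinsets τ 0).ncard = 1 ∧ (stableFinsets τ 1).ncard = q ∧
      ∀ n, (stableFinsets τ (n + 2)).ncard + q ^ (n + 1) = q ^ (n + 2) := by
  have key := ncard_stableMultisets hτ hfin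
  simp only [hq] at key
  refine ⟨by simpa using (key 0).symm, by simpa using (key 1).symm, fun n => ?_⟩
  have h := key (n + 2)
  rw [show (n + 2) / 2 + 1 = n / 2 + 1 + 1 by omega, Finset.sum_range_succ'] at h
  have h2 : ∑ k ∈ Finset.range (n / 2 + 1),
      (stableFinsets τ (n + 2 - 2 * (k + 1))).ncard * q ^ (k + 1) = q ^ (n + 1) := by
    rw [pow_succ q n, key n, Finset.sum_mul]
    refine Finset.sum_congr rfl fun k _ => ?_
    rw [show n + 2 - 2 * (k + 1) = n - 2 * k by omega, pow_succ, mul_assoc]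
  rw [h2] at h
  simp only [mul_zero, Nat.sub_zero, pow_zero, mul_one] at h
  omega

/-- A stable set either misses the orbit `O` or is obtained from a stable set missing `O` by
adjoining `O`. -/
theorem ncard_stableFinsets_add_card {τ : X → X} {O : Finset X} (hne : O.Nonempty)
    (hO : O.val.map τ = O.val) {n : ℕ}
    (hfin : {S ∈ stableFinsets τ (n + O.card) | Disjoint S O}.Finite)
    (hfin' : {S ∈ stableFinsets τ n | Disjoint S O}.Finite)
    (hsub : ∀ S : Finset X, S.val.map τ = S.val → O ⊆ S ∨ Disjoint S O) :
    (stableFinsets τ (n + O.card)).Finite ∧ (stableFinsets τ (n + O.card)).ncard =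
      {S ∈ stableFinsets τ (n + O.card) | Disjoint S O}.ncard +
        {S ∈ stableFinsets τ n | Disjoint S O}.ncard := by
  classical
  have hinj : Set.InjOn (· ∪ O) {S ∈ stableFinsets τ n | Disjoint S O} := by
    rintro S ⟨-, hS⟩ T ⟨-, hT⟩ h
    have h' := congrArg (· \ O) h
    simpa [Finset.union_sdiff_right, Finset.sdiff_eq_self_of_disjoint hS,
      Finset.sdiff_eq_self_of_disjoint hT] using h'
  have himg : (· ∪ O) '' {S ∈ stableFinsets τ n | Disjoint S O} =
      {S ∈ stableFinsets τ (n + O.card) | O ⊆ S} := by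
    ext T
    constructor
    · rintro ⟨S, ⟨⟨h1, h2⟩, h3⟩, rfl⟩
      refine ⟨?_, Finset.subset_union_right⟩
      change S ∪ O ∈ _
      rw [← Finset.disjUnion_eq_union S O h3]
      refine ⟨by rw [Finset.card_disjUnion, h1], ?_⟩
      rw [Finset.disjUnion_val, Multiset.map_add, h2, hO]
    · rintro ⟨⟨h1, h2⟩, h3⟩
      have hd : Disjoint (T \ O) O := Finset.sdiff_disjoint
      have hT : (T \ O).val + O.val = T.val := by
        rw [← Finset.disjUnion_val _ _ hd, Finset.disjUnion_eq_union,
          Finset.sdiff_union_of_subset h3]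
      refine ⟨T \ O, ⟨⟨?_, ?_⟩, hd⟩, Finset.sdiff_union_of_subset h3⟩
      · rw [Finset.card_sdiff_of_subset h3, h1, Nat.add_sub_cancel]
      · rw [← hT, Multiset.map_add, hO] at h2
        exact add_right_cancel h2
  have hunion : stableFinsets τ (n + O.card) =
      {S ∈ stableFinsets τ (n + O.card) | Disjoint S O} ∪
        {S ∈ stableFinsets τ (n + O.card) | O ⊆ S} := by
    ext S
    constructor
    · intro h
      exact (hsub S h.2).elim (fun h' => Or.inr ⟨h, h'⟩) (fun h' => Or.inl ⟨h, h'⟩)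
    · rintro (h | h) <;> exact h.1
  have hdisj : Disjoint {S ∈ stableFinsets τ (n + O.card) | Disjoint S O}
      {S ∈ stableFinsets τ (n + O.card) | O ⊆ S} := by
    rw [Set.disjoint_left]
    rintro S ⟨-, h1⟩ ⟨-, h3⟩
    obtain ⟨a, ha⟩ := hne
    exact Finset.disjoint_left.1 h1 (h3 ha) ha
  have hfin2 := himg ▸ hfin'.image (· ∪ O)
  refine ⟨hunion ▸ hfin.union hfin2, ?_⟩
  rw [← hinj.ncard_image, himg, ← Set.ncard_union_eq hdisj hfin hfin2, ← hunion]

theorem image_some_sep_stableFinsets (τ : X → X) (n : ℕ) :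
    Finset.map Function.Embedding.some '' stableFinsets τ n =
      {S ∈ stableFinsets (Option.map τ) n | Disjoint S {none}} := by
  ext S
  constructor
  · rintro ⟨T, ⟨h1, h2⟩, rfl⟩
    refine ⟨⟨by rw [Finset.card_map, h1], ?_⟩, by simp⟩
    rw [Finset.map_val, Multiset.map_map]
    conv_rhs => rw [← h2, Multiset.map_map]
    rfl
  · rintro ⟨⟨h1, h2⟩, h3⟩
    have hS : S.eraseNone.map Function.Embedding.some = S := by
      rw [Finset.map_some_eraseNone, Finset.erase_eq_of_notMem]
      simpa using h3
    refine ⟨S.eraseNone, ⟨?_, ?_⟩, hS⟩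
    · rw [← h1, ← Finset.card_map Function.Embedding.some, hS]
    · apply Multiset.map_injective (Option.some_injective X)
      rw [← hS, Finset.map_val, Multiset.map_map] at h2
      rw [Multiset.map_map]
      exact h2

theorem ncard_stableFinsets_sep_none (τ : X → X) (n : ℕ) :
    {S ∈ stableFinsets (Option.map τ) n | Disjoint S {none}}.ncard =
      (stableFinsets τ n).ncard := by
  rw [← image_some_sep_stableFinsets,
    Set.ncard_image_of_injective _ (Finset.map_injective _)]

theorem ncard_stableFinsets_option {τ : X → X} (hfin : ∀ n, (stableFinsets τ n).Finite) (n : ℕ) :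
    (stableFinsets (Option.map τ) (n + 1)).Finite ∧ (stableFinsets (Option.map τ) (n + 1)).ncard =
      (stableFinsets τ (n + 1)).ncard + (stableFinsets τ n).ncard := by
  have hf : ∀ n, {S ∈ stableFinsets (Option.map τ) n | Disjoint S {none}}.Finite := fun n =>
    image_some_sep_stableFinsets τ n ▸ (hfin n).image _
  have h := ncard_stableFinsets_add_card (τ := Option.map τ) (O := {none}) (n := n)
    (Finset.singleton_nonempty _) (by simp) (hf _) (hf _)
    (fun S _ => by
      by_cases hS : none ∈ S
      · exact Or.inl (by simpa using hS)
      · exact Or.inr (by simpa using hS))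
  rwa [Finset.card_singleton, ncard_stableFinsets_sep_none, ncard_stableFinsets_sep_none] at h

theorem stableFinsets_zero (τ : X → X) : stableFinsets τ 0 = {∅} := by
  ext S
  simp only [stableFinsets, Set.mem_ofPred_eq, Finset.card_eq_zero, Set.mem_singleton_iff]
  exact ⟨fun h => h.1, fun h => ⟨h, by simp [h]⟩⟩

/-- Counting stable sets missing an orbit `{a, b}` of size two, when the total number of stable
sets is that of the projective line over a field with `q` elements. -/
theorem ncard_stableFinsets_sep_pair {τ : X → X} {a b : X} (hab : a ≠ b)
    (ha : τ a = b) (hb : τ b = a) {q : ℕ} (hfin : ∀ n, (stableFinsets τ n).Finite)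
    (h1 : (stableFinsets τ 1).ncard = q + 1) (h2 : (stableFinsets τ 2).ncard = q ^ 2)
    (h3 : ∀ n, (stableFinsets τ (n + 3)).ncard + q ^ (n + 1) = q ^ (n + 3)) (n : ℕ) :
    ((q : ℤ) ^ 2 + 1) * ({S ∈ stableFinsets τ (n + 1) | a ∉ S ∧ b ∉ S}.ncard : ℤ) =
      ((q : ℤ) + 1) * ((q : ℤ) ^ (n + 2) - (q : ℤ) ^ (n + 1)
        - (-1) ^ ((n + 2) / 2) * (q : ℤ) + (-1) ^ ((n + 1) / 2)) := by
  classical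
  have hmem : ∀ S : Finset X, S.val.map τ = S.val → ∀ x ∈ S, τ x ∈ S := fun S hS x hx => by
    rw [← Finset.mem_val, ← hS]
    exact Multiset.mem_map_of_mem τ hx
  have hiff : ∀ S : Finset X, Disjoint S {a, b} ↔ a ∉ S ∧ b ∉ S := fun S => by
    simp [Finset.disjoint_insert_right]
  have hcard : ({a, b} : Finset X).card = 2 := Finset.card_pair hab
  have hstep : ∀ n, (stableFinsets τ (n + 2)).ncard =
      {S ∈ stableFinsets τ (n + 2) | a ∉ S ∧ b ∉ S}.ncard +
        {S ∈ stableFinsets τ n | a ∉ S ∧ b ∉ S}.ncard := by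
    intro n
    have h := (ncard_stableFinsets_add_card (τ := τ) (O := {a, b}) (n := n)
      (Finset.insert_nonempty _ _) (by
        rw [Finset.insert_val_of_notMem (by simpa using hab)]
        simp only [Finset.singleton_val, Multiset.map_cons, Multiset.map_singleton, ha, hb]
        exact Multiset.cons_swap _ _ _)
      ((hfin _).subset (Set.sep_subset _ _)) ((hfin _).subset (Set.sep_subset _ _))
      (fun S hS => by
        rw [hiff, Finset.insert_subset_iff, Finset.singleton_subset_iff]
        have := hmem S hS a
        have := hmem S hS b
        grind)).2
    simpa only [hcard, hiff] using h
  have h0 : {S ∈ stableFinsets τ 0 | a ∉ S ∧ b ∉ S}.ncard = 1 := by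
    rw [Set.ncard_eq_one]
    exact ⟨∅, by rw [stableFinsets_zero]; ext S; simp; rintro rfl; simp⟩
  have hone : {S ∈ stableFinsets τ 1 | a ∉ S ∧ b ∉ S}.ncard = q + 1 := by
    rw [← h1]
    congr 1
    ext S
    refine ⟨fun h => h.1, fun h => ⟨h, ?_⟩⟩
    have hle : S.card ≤ 1 := h.1.le
    rw [Finset.card_le_one] at hle
    have hA := hmem S h.2 a
    have hB := hmem S h.2 b
    rw [ha] at hA
    rw [hb] at hB
    exact ⟨fun h => hab (hle _ h _ (hA h)), fun h => hab (hle _ (hB h) _ h)⟩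
  induction n using Nat.twoStepInduction with
  | zero =>
    rw [hone]
    push_cast
    norm_num
    ring
  | one =>
    have h := hstep 0
    rw [h0, h2] at h
    have h' : ({S ∈ stableFinsets τ (1 + 1) | a ∉ S ∧ b ∉ S}.ncard : ℤ) = (q : ℤ) ^ 2 - 1 := by
      have : ((q ^ 2 : ℕ) : ℤ) = _ := congrArg Nat.cast h
      push_cast at this
      linarith
    rw [h']
    norm_num
    ring
  | more n ih _ =>
    have h : ((_ : ℕ) : ℤ) = _ := congrArg Nat.cast (hstep (n + 1))
    have h' : ((_ : ℕ) : ℤ) = _ := congrArg Nat.cast (h3 n)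
    push_cast at h h'
    rw [show (n + 2 + 2) / 2 = (n + 2) / 2 + 1 by omega,
      show (n + 2 + 1) / 2 = (n + 1) / 2 + 1 by omega]
    simp only [pow_succ _ ((n + 2) / 2), pow_succ _ ((n + 1) / 2)]
    simp only [show n + 1 + 2 = n + 3 from rfl, show n + 2 + 2 = n + 4 from rfl] at *
    linear_combination ((q : ℤ) ^ 2 + 1) * h' - ((q : ℤ) ^ 2 + 1) * h - ih

end StableSets

section Frobenius

theorem mem_range_algebraMap_of_pow_card_eq {K L : Type*} [Field K] [Fintype K] [Field L]
    [Algebra K L] {x : L} (hx : x ^ Fintype.card K = x) : ∃ y, algebraMap K L y = x := by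
  have hs : (X ^ Fintype.card K - X : K[X]).Splits := by
    rw [splits_iff_card_roots, FiniteField.roots_X_pow_card_sub_X, ← Finset.card_def,
      Finset.card_univ, FiniteField.X_pow_card_sub_X_natDegree_eq _ Fintype.one_lt_card]
  have h := hs.roots_map (algebraMap K L)
  have hmem : x ∈ ((X ^ Fintype.card K - X : K[X]).map (algebraMap K L)).roots := by
    rw [Polynomial.map_sub, Polynomial.map_pow, map_X,
      mem_roots (FiniteField.X_pow_card_sub_X_ne_zero L Fintype.one_lt_card)]
    simp [hx]
  rw [h, Multiset.mem_map] at hmem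
  obtain ⟨y, -, hy⟩ := hmem
  exact ⟨y, hy⟩

theorem bijOn_monic_natDegree_eq (K : Type*) [Field K] (n : ℕ) :
    Set.BijOn (fun f : K[X] => X ^ n + f) (degreeLT K n) {f | f.Monic ∧ f.natDegree = n} := by
  refine ⟨fun f hf => ?_, fun f _ g _ h => add_left_cancel h, ?_⟩
  · have hf' := mem_degreeLT.1 hf
    refine ⟨monic_X_pow_add hf', ?_⟩
    rw [natDegree_add_eq_left_of_degree_lt (by simpa using hf'), natDegree_X_pow]
  · rintro f ⟨hf, hn⟩
    refine ⟨f - X ^ n, mem_degreeLT.2 ?_, by simp⟩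
    have hd : f.degree = n := by rw [degree_eq_natDegree hf.ne_zero, hn]
    rw [← hd]
    exact degree_sub_lt_left (by simp [hd]) hf.ne_zero (by simp [hf.leadingCoeff])

variable (K L : Type*) [Field K] [Fintype K] [Field L] [IsAlgClosed L] [Algebra K L]

theorem bijOn_roots_stableMultisets (n : ℕ) :
    Set.BijOn (fun f : K[X] => (f.map (algebraMap K L)).roots) {f | f.Monic ∧ f.natDegree = n}
      (stableMultisets (fun x : L => x ^ Fintype.card K) n) := by
  have hφ := FiniteField.coe_frobeniusAlgHom K L
  set φ := FiniteField.frobeniusAlgHom K L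
  rw [← hφ]
  refine ⟨?_, ?_, ?_⟩
  · rintro f ⟨-, hn⟩
    have hs := IsAlgClosed.splits (f.map (algebraMap K L))
    refine ⟨by rw [← hs.natDegree_eq_card_roots, natDegree_map, hn], ?_⟩
    have := hs.roots_map (φ : L →+* L)
    rw [Polynomial.map_map, AlgHom.comp_algebraMap] at this
    exact this.symm
  · rintro f ⟨hf, -⟩ g ⟨hg, -⟩ h
    apply Polynomial.map_injective _ (algebraMap K L).injective
    rw [(IsAlgClosed.splits (f.map (algebraMap K L))).eq_prod_roots_of_monic (hf.map _),
      (IsAlgClosed.splits (g.map (algebraMap K L))).eq_prod_roots_of_monic (hg.map _)]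
    exact congrArg (fun m : Multiset L => (m.map fun a => X - C a).prod) h
  · rintro m ⟨hc, hm⟩
    have hfix : ((m.map fun a => X - C a).prod).map (φ : L →+* L) =
        (m.map fun a => X - C a).prod := by
      conv_rhs => rw [← hm]
      rw [Polynomial.map_multiset_prod, Multiset.map_map, Multiset.map_map]
      simp
    have hl : (m.map fun a => X - C a).prod ∈ lifts (algebraMap K L) := by
      rw [lifts_iff_coeff_lifts]
      intro i
      apply mem_range_algebraMap_of_pow_card_eq
      have := congrArg (fun p => coeff p i) hfix
      simp only [coeff_map, RingHom.coe_coe, hφ] at this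
      exact this
    obtain ⟨f, hf, hd, hmon⟩ := lifts_and_natDegree_eq_and_monic hl
      (monic_multiset_prod_of_monic _ _ fun a _ => monic_X_sub_C a)
    refine ⟨f, ⟨hmon, ?_⟩, ?_⟩
    · rw [hd, natDegree_multiset_prod_X_sub_C_eq_card, hc]
    · simp only [hf, roots_multiset_prod_X_sub_C]

theorem stableMultisets_pow_card (n : ℕ) :
    (stableMultisets (fun x : L => x ^ Fintype.card K) n).Finite ∧
      (stableMultisets (fun x : L => x ^ Fintype.card K) n).ncard = Fintype.card K ^ n := by
  have hb := (bijOn_roots_stableMultisets K L n).comp (bijOn_monic_natDegree_eq K n)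
  have e := (degreeLTEquiv K n).toEquiv
  have hfin : (degreeLT K n : Set K[X]).Finite :=
    Set.finite_coe_iff.1 (Finite.of_equiv _ e.symm)
  rw [← hb.image_eq, hb.injOn.ncard_image]
  refine ⟨hfin.image _, ?_⟩
  rw [← Nat.card_coe_set_eq]
  exact (Nat.card_congr e).trans (by simp)

theorem image_eq_iff_map_val_eq {Y : Type*} [DecidableEq Y] {τ : Y → Y} (hτ : τ.Injective)
    {S : Finset Y} : S.image τ = S ↔ S.val.map τ = S.val := by
  rw [← Finset.val_inj, Finset.image_val_of_injOn hτ.injOn]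

end Frobenius

theorem stmt13 {F : Type} [Field F] [Fintype F]
    (x₀ : AlgebraicClosure F)
    (hx₀ : x₀ ^ Fintype.card F ^ 2 = x₀) (hx₀' : x₀ ^ Fintype.card F ≠ x₀)
    (n : ℕ) (hn : 1 ≤ n) :
    ((Fintype.card F : ℤ) ^ 2 + 1) *
      (Set.ncard {S : Finset (Option (AlgebraicClosure F)) |
          some x₀ ∉ S ∧ some (x₀ ^ Fintype.card F) ∉ S ∧
          S.card = n ∧ S.image (frobP1 F) = S} : ℤ)
    = ((Fintype.card F : ℤ) + 1) *
        ((Fintype.card F : ℤ) ^ (n + 1) - (Fintype.card F : ℤ) ^ n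
            - (-1) ^ ((n + 1) / 2) * (Fintype.card F : ℤ) + (-1) ^ (n / 2)) := by
  obtain ⟨n, rfl⟩ := Nat.exists_eq_add_of_le' hn
  set q := Fintype.card F with hq
  set τ : AlgebraicClosure F → AlgebraicClosure F := fun x => x ^ q with hτ
  have hinj : τ.Injective := by
    rw [hτ, hq, ← FiniteField.coe_frobeniusAlgHom]
    exact RingHom.injective (FiniteField.frobeniusAlgHom F (AlgebraicClosure F)).toRingHom
  have hM : ∀ n, (stableMultisets τ n).Finite ∧ (stableMultisets τ n).ncard = q ^ n :=
    stableMultisets_pow_card F (AlgebraicClosure F)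
  obtain ⟨h0, h1, h2⟩ := ncard_stableFinsets_of_pow hinj (fun n => (hM n).1) (fun n => (hM n).2)
  have hP := ncard_stableFinsets_option fun n => finite_stableFinsets (hM n).1
  have key := ncard_stableFinsets_sep_pair (τ := Option.map τ) (a := some x₀)
    (b := some (x₀ ^ q)) (q := q) (fun h => hx₀' (Option.some_injective _ h).symm) rfl
    (by
      rw [Option.map_some, hτ]
      simp only
      rw [← pow_mul, ← sq, hx₀])
    (fun n => by
      cases n with
      | zero => rw [stableFinsets_zero]; exact Set.finite_singleton _
      | succ n => exact (hP n).1)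
    (by rw [(hP 0).2, h0, h1])
    (by rw [(hP 1).2, h1]; have := h2 0; simp only [zero_add, pow_one] at this; exact this)
    (fun n => by
      rw [(hP (n + 2)).2]
      have e1 := h2 n
      have e2 := h2 (n + 1)
      simp only [show n + 1 + 2 = n + 3 from rfl, show n + 1 + 1 = n + 2 from rfl] at e1 e2 ⊢
      omega) n
  rw [← key]
  congr 3
  ext S
  have himg : S.image (frobP1 F) = S ↔ S.val.map (Option.map τ) = S.val :=
    image_eq_iff_map_val_eq (Option.map_injective hinj)
  simp only [Set.mem_ofPred_eq, stableFinsets, himg]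
  tauto

end Hyp
end
end
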